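/- Let 0 < p < 1 be a probability. There exist constants c, C > 0 depending only on p such that for all positive integers n: (a) for every positive integer m, E[|min(B_{n,m,p})|] ≤ C·(1+p)^n/√n; and (b) there exists a positive integer m (one can take m = ⌈(1-p)^{-n/(1+p)}⌉) with E[|min(B_{n,m,p})|] ≥ c·(1+p)^n/√n. Consequently max_{m ≥ 1} E[|min(B_{n,m,p})|] = Θ((1+p)^n/√n). -/

import Mathlib

open MeasureTheory

/-- The Bernoulli(p) measure on `Bool`. -/
noncomputable def bernoulliBool (p : ℝ) : Measure Bool :=
  ENNReal.ofReal p • Measure.dirac true + ENNReal.ofReal (1 - p) • Measure.dirac false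

instance (p : ℝ) : IsFiniteMeasure (bernoulliBool p) := by
  constructor
  rw [bernoulliBool]
  simp [ENNReal.add_lt_top]

/-- The law of `m` i.i.d. random subsets of `{1,…,n}` (encoded as indicator vectors),
each element included independently with probability `p`. -/
noncomputable def hyperMeasure (n m : ℕ) (p : ℝ) : Measure (Fin m → Fin n → Bool) :=
  Measure.pi fun _ : Fin m => Measure.pi fun _ : Fin n => bernoulliBool p

/-- The subset of `Fin n` encoded by an indicator vector. -/
def toSet {n : ℕ} (f : Fin n → Bool) : Finset (Fin n) :=
  Finset.univ.filter fun i => f i = true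

/-- The number of distinct minimal edges of the sampled multi-hypergraph:
sets `S` that occur among the samples and such that no sample is a proper subset of `S`. -/
def minCount (n m : ℕ) (ω : Fin m → Fin n → Bool) : ℕ :=
  (Finset.univ.filter fun S : Finset (Fin n) =>
    (∃ j, toSet (ω j) = S) ∧ ∀ k, ¬ toSet (ω k) ⊂ S).card

/-- Expected size of the minimization of `B_{n,m,p}`. -/
noncomputable def expMin (n m : ℕ) (p : ℝ) : ℝ :=
  ∫ ω, (minCount n m ω : ℝ) ∂(hyperMeasure n m p)


theorem bernoulliBool_singleton (p : ℝ) (b : Bool) :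
    bernoulliBool p {b} = ENNReal.ofReal (if b then p else 1 - p) := by
  cases b <;> simp [bernoulliBool]

theorem isProbabilityMeasure_bernoulliBool {p : ℝ} (hp0 : 0 ≤ p) (hp1 : p ≤ 1) :
    IsProbabilityMeasure (bernoulliBool p) := by
  constructor
  simp only [bernoulliBool, Measure.coe_add, Measure.coe_smul, Pi.add_apply, Pi.smul_apply,
    measure_univ, smul_eq_mul, mul_one]
  rw [← ENNReal.ofReal_add hp0 (by linarith)]
  simp

/-- The law of a single random subset. -/
noncomputable def edgeMeasure (n : ℕ) (p : ℝ) : Measure (Fin n → Bool) :=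
  Measure.pi fun _ => bernoulliBool p

theorem isProbabilityMeasure_edgeMeasure (n : ℕ) {p : ℝ} (hp0 : 0 ≤ p) (hp1 : p ≤ 1) :
    IsProbabilityMeasure (edgeMeasure n p) := by
  have := isProbabilityMeasure_bernoulliBool hp0 hp1
  unfold edgeMeasure
  infer_instance

theorem mem_toSet {n : ℕ} {f : Fin n → Bool} {i : Fin n} : i ∈ toSet f ↔ f i = true := by
  simp [toSet]

theorem edgeMeasure_toSet_subset {n : ℕ} {p : ℝ} (hp0 : 0 ≤ p) (hp1 : p ≤ 1)
    (S : Finset (Fin n)) :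
    (edgeMeasure n p).real {f | toSet f ⊆ S} = (1 - p) ^ (n - S.card) := by
  have := isProbabilityMeasure_bernoulliBool hp0 hp1
  have hset : {f : Fin n → Bool | toSet f ⊆ S} =
      Set.univ.pi fun i => if i ∈ S then Set.univ else {false} := by
    ext f
    simp only [Set.mem_ofPred_eq, Finset.subset_iff, mem_toSet, Set.mem_univ_pi]
    refine forall_congr' fun i => ?_
    by_cases hi : i ∈ S <;> simp [hi]
  rw [measureReal_def, hset, edgeMeasure, Measure.pi_pi, ENNReal.toReal_prod]
  have hfac : ∀ i : Fin n, (bernoulliBool p (if i ∈ S then Set.univ else {false})).toReal =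
      if i ∈ S then 1 else 1 - p := by
    intro i
    by_cases hi : i ∈ S
    · rw [if_pos hi, if_pos hi, measure_univ, ENNReal.toReal_one]
    · simp [hi, bernoulliBool_singleton, hp1]
  simp only [hfac]
  rw [Finset.prod_ite]
  simp [Finset.filter_not, Finset.card_sdiff]

theorem edgeMeasure_toSet_eq {n : ℕ} {p : ℝ} (hp0 : 0 ≤ p) (hp1 : p ≤ 1)
    (S : Finset (Fin n)) :
    (edgeMeasure n p).real {f | toSet f = S} = p ^ S.card * (1 - p) ^ (n - S.card) := by
  have := isProbabilityMeasure_bernoulliBool hp0 hp1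
  have hset : {f : Fin n → Bool | toSet f = S} = Set.univ.pi fun i => {decide (i ∈ S)} := by
    ext f
    simp only [Set.mem_ofPred_eq, Finset.ext_iff, mem_toSet, Set.mem_univ_pi]
    refine forall_congr' fun i => ?_
    by_cases hi : i ∈ S <;> simp [hi]
  rw [measureReal_def, hset, edgeMeasure, Measure.pi_pi, ENNReal.toReal_prod]
  have hfac : ∀ i : Fin n, (bernoulliBool p {decide (i ∈ S)}).toReal =
      if i ∈ S then p else 1 - p := by
    intro i
    by_cases hi : i ∈ S
    · simp [hi, bernoulliBool_singleton, hp0]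
    · simp [hi, bernoulliBool_singleton, hp1]
  simp only [hfac]
  rw [Finset.prod_ite]
  simp [Finset.filter_not, Finset.card_sdiff]

theorem edgeMeasure_toSet_ssubset {n : ℕ} {p : ℝ} (hp0 : 0 ≤ p) (hp1 : p ≤ 1)
    (S : Finset (Fin n)) :
    (edgeMeasure n p).real {f | toSet f ⊂ S} =
      (1 - p) ^ (n - S.card) - p ^ S.card * (1 - p) ^ (n - S.card) := by
  have := isProbabilityMeasure_edgeMeasure n hp0 hp1
  rw [← edgeMeasure_toSet_eq hp0 hp1 S, ← edgeMeasure_toSet_subset hp0 hp1 S,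
    ← measureReal_sdiff _ (Set.toFinite _).measurableSet]
  · congr 1
    ext f
    simp [Finset.ssubset_iff_subset_ne]
  · intro f hf
    exact Finset.Subset.antisymm_iff.1 hf |>.1

theorem hyperMeasure_forall_notMem {n m : ℕ} {p : ℝ} (hp0 : 0 ≤ p) (hp1 : p ≤ 1)
    (s : Set (Fin n → Bool)) :
    (hyperMeasure n m p).real {ω | ∀ k, ω k ∉ s} = (1 - (edgeMeasure n p).real s) ^ m := by
  have := isProbabilityMeasure_edgeMeasure n hp0 hp1
  have hset : {ω : Fin m → Fin n → Bool | ∀ k, ω k ∉ s} = Set.univ.pi fun _ => sᶜ := by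
    ext ω
    simp
  rw [← probReal_compl_eq_one_sub (Set.toFinite s).measurableSet, measureReal_def, hset,
    hyperMeasure]
  change (Measure.pi (fun _ : Fin m => edgeMeasure n p) _).toReal = _
  rw [Measure.pi_pi, ENNReal.toReal_prod]
  simp [measureReal_def]

theorem minCount_eq_sum {n m : ℕ} (ω : Fin m → Fin n → Bool) :
    (minCount n m ω : ℝ) = ∑ S : Finset (Fin n),
      ({ω : Fin m → Fin n → Bool | ∀ k, ω k ∉ {f | toSet f ⊂ S}}.indicator 1 ω -
        {ω : Fin m → Fin n → Bool | ∀ k, ω k ∉ {f | toSet f ⊆ S}}.indicator 1 ω) := by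
  rw [minCount, Finset.card_filter, Nat.cast_sum]
  refine Finset.sum_congr rfl fun S _ => ?_
  simp only [Set.indicator_apply, Set.mem_ofPred_eq, Pi.one_apply]
  by_cases h : ∀ k, ¬ toSet (ω k) ⊂ S
  · by_cases h' : ∃ j, toSet (ω j) = S
    · obtain ⟨j, hj⟩ := h'
      have : ¬ ∀ k, ¬ toSet (ω k) ⊆ S := fun H => H j hj.subset
      simp [h, this, show ∃ j, toSet (ω j) = S from ⟨j, hj⟩]
    · have : ∀ k, ¬ toSet (ω k) ⊆ S := fun k hk =>
        h k (Finset.ssubset_iff_subset_ne.2 ⟨hk, fun e => h' ⟨k, e⟩⟩)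
      simp [h, this, h']
  · have : ¬ ∀ k, ¬ toSet (ω k) ⊆ S := fun H => h fun k hk => H k hk.subset
    simp [h, this]

theorem expMin_eq_sum (n m : ℕ) {p : ℝ} (hp0 : 0 ≤ p) (hp1 : p ≤ 1) :
    expMin n m p = ∑ k ∈ Finset.range (n + 1), (n.choose k : ℝ) *
      ((1 - ((1 - p) ^ (n - k) - p ^ k * (1 - p) ^ (n - k))) ^ m -
        (1 - (1 - p) ^ (n - k)) ^ m) := by
  have := isProbabilityMeasure_edgeMeasure n hp0 hp1
  have : IsProbabilityMeasure (hyperMeasure n m p) := by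
    change IsProbabilityMeasure (Measure.pi fun _ : Fin m => edgeMeasure n p)
    infer_instance
  simp only [expMin, minCount_eq_sum]
  rw [integral_finsetSum _ fun _ _ => Integrable.of_finite]
  have hterm : ∀ S : Finset (Fin n), ∫ ω, ({ω : Fin m → Fin n → Bool |
        ∀ k, ω k ∉ {f | toSet f ⊂ S}}.indicator (1 : (Fin m → Fin n → Bool) → ℝ) ω -
        {ω : Fin m → Fin n → Bool | ∀ k, ω k ∉ {f | toSet f ⊆ S}}.indicator 1 ω)
          ∂(hyperMeasure n m p) =
      (1 - ((1 - p) ^ (n - S.card) - p ^ S.card * (1 - p) ^ (n - S.card))) ^ m -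
        (1 - (1 - p) ^ (n - S.card)) ^ m := by
    intro S
    rw [integral_sub Integrable.of_finite Integrable.of_finite,
      integral_indicator_one (Set.toFinite _).measurableSet,
      integral_indicator_one (Set.toFinite _).measurableSet,
      hyperMeasure_forall_notMem hp0 hp1, hyperMeasure_forall_notMem hp0 hp1,
      edgeMeasure_toSet_ssubset hp0 hp1, edgeMeasure_toSet_subset hp0 hp1]
  rw [Finset.sum_congr rfl fun S _ => hterm S, ← Finset.powerset_univ,
    Finset.sum_powerset_apply_card fun k : ℕ =>
      (1 - ((1 - p) ^ (n - k) - p ^ k * (1 - p) ^ (n - k))) ^ m - (1 - (1 - p) ^ (n - k)) ^ m]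
  simp

theorem bernstein_sum_eq_one (n : ℕ) (r : ℝ) :
    ∑ k ∈ Finset.range (n + 1), (n.choose k : ℝ) * r ^ k * (1 - r) ^ (n - k) = 1 := by
  have := congrArg (Polynomial.eval r) (bernsteinPolynomial.sum ℝ n)
  simpa [bernsteinPolynomial, Polynomial.eval_finsetSum] using this

theorem bernstein_sum_sq (n : ℕ) (r : ℝ) :
    ∑ k ∈ Finset.range (n + 1), (n * r - k) ^ 2 * ((n.choose k : ℝ) * r ^ k * (1 - r) ^ (n - k)) =
      n * r * (1 - r) := by
  have := congrArg (Polynomial.eval r) (bernsteinPolynomial.variance ℝ n)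
  simpa [bernsteinPolynomial, Polynomial.eval_finsetSum] using this

theorem factorial_le_stirling {n : ℕ} (hn : 0 < n) :
    (n.factorial : ℝ) ≤ Real.exp 1 * √n * (n / Real.exp 1) ^ n := by
  obtain ⟨k, rfl⟩ := Nat.exists_eq_succ_of_ne_zero hn.ne'
  have h := Stirling.stirlingSeq'_antitone (Nat.zero_le k)
  simp only [Function.comp, Nat.succ_eq_add_one, zero_add, Stirling.stirlingSeq_one] at h
  rw [Stirling.stirlingSeq, div_le_iff₀ (by positivity)] at h
  refine h.trans_eq ?_
  rw [Real.sqrt_mul (by norm_num)]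
  field_simp

theorem pow_le_natCast_pow_mul_exp (k : ℕ) {x : ℝ} (hx : 0 ≤ x) :
    x ^ k ≤ (k : ℝ) ^ k * Real.exp (x - k) := by
  rcases Nat.eq_zero_or_pos k with rfl | hk
  · simpa using hx
  have hk' : (0 : ℝ) < k := by exact_mod_cast hk
  have h : x / k ≤ Real.exp (x / k - 1) := by linarith [Real.add_one_le_exp (x / k - 1)]
  have h2 := pow_le_pow_left₀ (by positivity) h k
  rw [← Real.exp_nat_mul, mul_sub, mul_div_cancel₀ _ hk'.ne', mul_one, div_pow,
    div_le_iff₀ (by positivity)] at h2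
  linarith

theorem bernstein_mul_sqrt_le {n k : ℕ} (hn : 0 < n) (hk : k ≤ n) {r : ℝ} (hr0 : 0 < r)
    (hr1 : r < 1) :
    (n.choose k : ℝ) * r ^ k * (1 - r) ^ (n - k) *
      (√(2 * Real.pi * k) * √(2 * Real.pi * ((n - k : ℕ) : ℝ))) ≤ Real.exp 1 * √n := by
  obtain ⟨l, rfl⟩ := Nat.exists_eq_add_of_le hk
  rw [Nat.add_sub_cancel_left]
  set N : ℝ := ((k + l : ℕ) : ℝ) with hN
  have hNpos : 0 < N := by rw [hN]; exact_mod_cast hn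
  have hs : 0 < 1 - r := by linarith
  have hE : (0 : ℝ) < Real.exp 1 := Real.exp_pos 1
  have hfac : ((k + l).choose k : ℝ) * (k.factorial * l.factorial) ≤
      Real.exp 1 * √N * (N / Real.exp 1) ^ (k + l) := by
    refine le_trans (le_of_eq ?_) (factorial_le_stirling hn)
    rw [← mul_assoc, Nat.choose_symm_add]
    exact_mod_cast Nat.add_choose_mul_factorial_mul_factorial k l
  have hpow : N ^ (k + l) * (r ^ k * (1 - r) ^ l) ≤ (k : ℝ) ^ k * (l : ℝ) ^ l := by
    have h1 := pow_le_natCast_pow_mul_exp k (x := N * r) (by positivity)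
    have h2 := pow_le_natCast_pow_mul_exp l (x := N * (1 - r)) (by positivity)
    have h3 := mul_le_mul h1 h2 (by positivity) (by positivity)
    have h4 : Real.exp (N * r - k) * Real.exp (N * (1 - r) - l) = 1 := by
      rw [← Real.exp_add, Real.exp_eq_one_iff, hN]
      push_cast
      ring
    calc N ^ (k + l) * (r ^ k * (1 - r) ^ l) = (N * r) ^ k * (N * (1 - r)) ^ l := by
          rw [mul_pow, mul_pow, pow_add]; ring
      _ ≤ _ := h3
      _ = (k : ℝ) ^ k * (l : ℝ) ^ l *
          (Real.exp (N * r - k) * Real.exp (N * (1 - r) - l)) := by ring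
      _ = _ := by rw [h4, mul_one]
  have hkl : (k / Real.exp 1) ^ k * (l / Real.exp 1) ^ l *
      (√(2 * Real.pi * k) * √(2 * Real.pi * l)) ≤ (k.factorial * l.factorial : ℝ) := by
    calc _ = (√(2 * Real.pi * k) * (k / Real.exp 1) ^ k) *
          (√(2 * Real.pi * l) * (l / Real.exp 1) ^ l) := by ring
      _ ≤ _ := by
        gcongr
        · exact Stirling.le_factorial_stirling k
        · exact Stirling.le_factorial_stirling l
  have hpos : 0 < (N / Real.exp 1) ^ (k + l) := by positivity
  refine le_of_mul_le_mul_right ?_ hpos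
  refine le_trans ?_ hfac
  calc _ = ((k + l).choose k : ℝ) * (N ^ (k + l) * (r ^ k * (1 - r) ^ l) /
          Real.exp 1 ^ (k + l) * (√(2 * Real.pi * k) * √(2 * Real.pi * l))) := by
        rw [div_pow]; ring
    _ ≤ ((k + l).choose k : ℝ) * ((k : ℝ) ^ k * (l : ℝ) ^ l /
          Real.exp 1 ^ (k + l) * (√(2 * Real.pi * k) * √(2 * Real.pi * l))) := by gcongr
    _ = ((k + l).choose k : ℝ) * ((k / Real.exp 1) ^ k * (l / Real.exp 1) ^ l *
          (√(2 * Real.pi * k) * √(2 * Real.pi * l))) := by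
        rw [div_pow, div_pow, pow_add]; field_simp
    _ ≤ _ := by gcongr

theorem exists_bernstein_le (r : ℝ) (hr0 : 0 < r) (hr1 : r < 1) :
    ∃ C > (0 : ℝ), ∀ n : ℕ, 0 < n → ∀ k ≤ n,
      (n.choose k : ℝ) * r ^ k * (1 - r) ^ (n - k) ≤ C / √n := by
  have hs : 0 < 1 - r := by linarith
  set δ := r * (1 - r) / 2 with hδ
  have hδ0 : 0 < δ := by positivity
  refine ⟨Real.exp 1 / √(r * (1 - r)) + 1 / δ ^ 2, by positivity, fun n hn k hk => ?_⟩
  have hn' : (1 : ℝ) ≤ n := by exact_mod_cast hn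
  have hsq : √(n : ℝ) * √n = n := Real.mul_self_sqrt (by positivity)
  have hsn : 1 ≤ √(n : ℝ) := Real.one_le_sqrt.2 hn'
  set w := (n.choose k : ℝ) * r ^ k * (1 - r) ^ (n - k) with hw
  have hw0 : 0 ≤ w := by positivity
  rw [add_div]
  by_cases h : δ ^ 2 * n ^ 2 ≤ (n * r - k) ^ 2
  · refine le_add_of_nonneg_of_le (by positivity) ?_
    have h1 : (n * r - k) ^ 2 * w ≤ n * r * (1 - r) := by
      rw [← bernstein_sum_sq n r]
      exact Finset.single_le_sum
        (f := fun k : ℕ => (n * r - k) ^ 2 * ((n.choose k : ℝ) * r ^ k * (1 - r) ^ (n - k)))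
        (fun i _ => by positivity) (Finset.mem_range.2 (by omega))
    have h2 : n * (δ ^ 2 * n * w) ≤ n * 1 := by
      calc n * (δ ^ 2 * n * w) = δ ^ 2 * n ^ 2 * w := by ring
        _ ≤ (n * r - k) ^ 2 * w := by gcongr
        _ ≤ _ := h1
        _ ≤ n * 1 := by
          rw [mul_assoc]
          gcongr
          nlinarith
    have h3 : δ ^ 2 * n * w ≤ 1 := le_of_mul_le_mul_left h2 (by linarith)
    rw [div_div, le_div_iff₀ (by positivity)]
    calc w * (δ ^ 2 * √n) = δ ^ 2 * √n * w := by ring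
      _ ≤ δ ^ 2 * (√n * √n) * w := by
        gcongr
        nlinarith
      _ ≤ 1 := by rw [hsq]; exact h3
  · refine le_add_of_le_of_nonneg ?_ (by positivity)
    have habs : |n * r - k| < δ * n := by
      rw [← mul_pow, sq_le_sq, not_le, abs_of_pos (by positivity : 0 < δ * n)] at h
      exact h
    obtain ⟨ha, hb⟩ := abs_lt.1 habs
    have hkr : n * r / 2 ≤ k := by nlinarith
    have hlr : n * (1 - r) / 2 ≤ ((n - k : ℕ) : ℝ) := by
      rw [Nat.cast_sub hk]
      nlinarith
    have hpi : (1 : ℝ) ≤ Real.pi := by linarith [Real.pi_gt_three]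
    have hb := bernstein_mul_sqrt_le hn hk hr0 hr1
    have hk2 : n * r ≤ 2 * Real.pi * k := by nlinarith
    have hl2 : n * (1 - r) ≤ 2 * Real.pi * ((n - k : ℕ) : ℝ) := by
      nlinarith [mul_pos (by linarith : (0 : ℝ) < n) hs]
    have hprod : √(n : ℝ) * (√n * √(r * (1 - r))) ≤
        √(2 * Real.pi * k) * √(2 * Real.pi * ((n - k : ℕ) : ℝ)) := by
      calc _ = √(n * r) * √(n * (1 - r)) := by
            rw [Real.sqrt_mul hr0.le, Real.sqrt_mul (by positivity), Real.sqrt_mul (by positivity)]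
            ring
        _ ≤ _ := by gcongr
    have h4 : √(n : ℝ) * (w * (√n * √(r * (1 - r)))) ≤ √n * Real.exp 1 := by
      calc _ = w * (√(n : ℝ) * (√n * √(r * (1 - r)))) := by ring
        _ ≤ _ := mul_le_mul_of_nonneg_left hprod hw0
        _ ≤ _ := hb
        _ = _ := mul_comm _ _
    have h5 := le_of_mul_le_mul_left h4 (by positivity)
    rw [div_div, le_div_iff₀ (by positivity)]
    linarith

theorem exists_le_bernstein {n : ℕ} (hn : 0 < n) {r : ℝ} (hr0 : 0 < r) (hr1 : r < 1) :
    ∃ k ≤ n, 1 / (5 * √n) ≤ (n.choose k : ℝ) * r ^ k * (1 - r) ^ (n - k) := by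
  have hs : 0 < 1 - r := by linarith
  have hn' : (1 : ℝ) ≤ n := by exact_mod_cast hn
  have hsq : √(n : ℝ) * √n = n := Real.mul_self_sqrt (by positivity)
  have hsn : 1 ≤ √(n : ℝ) := Real.one_le_sqrt.2 hn'
  set w : ℕ → ℝ := fun k => (n.choose k : ℝ) * r ^ k * (1 - r) ^ (n - k) with hw
  have hw0 : ∀ k, 0 ≤ w k := fun k => by positivity
  by_contra! hcon
  set I := Finset.Icc ⌈n * r - √n⌉₊ ⌊n * r + √n⌋₊ with hI
  have hcard : (I.card : ℝ) ≤ 2 * √n + 1 := by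
    rw [hI, Nat.card_Icc]
    have h1 : (⌊n * r + √n⌋₊ : ℝ) ≤ n * r + √n := Nat.floor_le (by positivity)
    have h2 : n * r - √n ≤ (⌈n * r - √n⌉₊ : ℝ) := Nat.le_ceil _
    rcases le_total ⌈n * r - √n⌉₊ (⌊n * r + √n⌋₊ + 1) with h | h
    · rw [Nat.cast_sub h]
      push_cast
      linarith
    · rw [Nat.sub_eq_zero_of_le h]
      simp only [Nat.cast_zero]
      positivity
  have hpt : ∀ k ∈ Finset.range (n + 1),
      w k ≤ (if k ∈ I then 1 / (5 * √n) else 0) + (n * r - k) ^ 2 * w k / n := by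
    intro k hk
    by_cases hkI : k ∈ I
    · rw [if_pos hkI]
      refine le_add_of_le_of_nonneg (hcon k (by simpa [Nat.lt_succ_iff] using hk)).le ?_
      have := hw0 k
      positivity
    · rw [if_neg hkI, zero_add, le_div_iff₀ (by linarith), mul_comm]
      refine mul_le_mul_of_nonneg_right ?_ (hw0 k)
      rw [hI, Finset.mem_Icc, Nat.ceil_le, Nat.le_floor_iff (by positivity), not_and_or, not_le,
        not_le] at hkI
      have : √(n : ℝ) ≤ |n * r - k| := by
        rcases hkI with h | h
        · exact le_abs.2 (Or.inl (by linarith))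
        · exact le_abs.2 (Or.inr (by linarith))
      calc (n : ℝ) = √n ^ 2 := by rw [sq, hsq]
        _ ≤ |n * r - k| ^ 2 := by gcongr
        _ = _ := sq_abs _
  have hsum := Finset.sum_le_sum hpt
  rw [bernstein_sum_eq_one, Finset.sum_add_distrib, ← Finset.sum_div, bernstein_sum_sq,
    ← Finset.sum_filter, Finset.sum_const, nsmul_eq_mul] at hsum
  have hc2 : (((Finset.range (n + 1)).filter (· ∈ I)).card : ℝ) ≤ 2 * √n + 1 := by
    refine le_trans ?_ hcard
    exact_mod_cast Finset.card_le_card fun x hx => (Finset.mem_filter.1 hx).2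
  have h1 : (((Finset.range (n + 1)).filter (· ∈ I)).card : ℝ) * (1 / (5 * √n)) ≤ 3 / 5 := by
    rw [mul_one_div, div_le_iff₀ (by positivity)]
    linarith
  have h2 : n * r * (1 - r) / n ≤ 1 / 4 := by
    rw [div_le_iff₀ (by linarith)]
    nlinarith [mul_nonneg (by linarith : (0 : ℝ) ≤ n) (sq_nonneg (2 * r - 1))]
  linarith

theorem pow_succ_sub_pow_succ_le {x y : ℝ} (hy : 0 ≤ y) (hxy : y ≤ x) (m : ℕ) :
    x ^ (m + 1) - y ^ (m + 1) ≤ (m + 1) * (x - y) * x ^ m := by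
  induction m with
  | zero => simp
  | succ m ih =>
    have hx : 0 ≤ x := hy.trans hxy
    have h1 : (x - y) * y ^ (m + 1) ≤ (x - y) * x ^ (m + 1) :=
      mul_le_mul_of_nonneg_left (pow_le_pow_left₀ hy hxy _) (by linarith)
    have h2 := mul_le_mul_of_nonneg_left ih hx
    push_cast
    calc x ^ (m + 1 + 1) - y ^ (m + 1 + 1) =
          x * (x ^ (m + 1) - y ^ (m + 1)) + (x - y) * y ^ (m + 1) := by ring
      _ ≤ x * ((m + 1) * (x - y) * x ^ m) + (x - y) * x ^ (m + 1) := add_le_add h2 h1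
      _ = _ := by ring

theorem le_pow_succ_sub_pow_succ {x y : ℝ} (hy : 0 ≤ y) (hxy : y ≤ x) (m : ℕ) :
    (m + 1) * (x - y) * y ^ m ≤ x ^ (m + 1) - y ^ (m + 1) := by
  induction m with
  | zero => simp
  | succ m ih =>
    have h1 : (x - y) * y ^ (m + 1) ≤ (x - y) * x ^ (m + 1) :=
      mul_le_mul_of_nonneg_left (pow_le_pow_left₀ hy hxy _) (by linarith)
    have h2 := mul_le_mul_of_nonneg_left ih hy
    push_cast
    calc ((m : ℝ) + 1 + 1) * (x - y) * y ^ (m + 1) =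
          y * ((m + 1) * (x - y) * y ^ m) + (x - y) * y ^ (m + 1) := by ring
      _ ≤ y * (x ^ (m + 1) - y ^ (m + 1)) + (x - y) * x ^ (m + 1) := add_le_add h2 h1
      _ = _ := by ring

theorem sum_min_geometric_le {q : ℝ} (hq0 : 0 < q) (hq1 : q < 1) (N : ℕ) {y : ℝ} (hy : 0 < y) :
    ∑ j ∈ Finset.range N, min (y * q ^ j) (1 / (y * q ^ j)) ≤ 2 / (1 - q) := by
  have hs : 0 < 1 - q := by linarith
  have key : ∀ N : ℕ, ∀ y : ℝ, 0 < y →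
      ∑ j ∈ Finset.range N, min (y * q ^ j) (1 / (y * q ^ j)) ≤
        if y ≤ 1 then y / (1 - q) else (2 - q / y) / (1 - q) := by
    intro N
    induction N with
    | zero =>
      intro y hy
      rw [Finset.sum_range_zero]
      split_ifs with h
      · positivity
      · have : q / y ≤ 1 := by
          rw [div_le_one hy]
          linarith
        exact div_nonneg (by linarith) hs.le
    | succ N ih =>
      intro y hy
      rw [Finset.sum_range_succ']
      have hstep := ih (y * q) (by positivity)
      have hre : ∀ j : ℕ, y * q ^ (j + 1) = y * q * q ^ j := fun j => by ring
      simp only [hre, pow_zero, mul_one]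
      have hyq : y * q ≤ y := mul_le_of_le_one_right hy.le hq1.le
      split_ifs with h
      · rw [if_pos (by linarith)] at hstep
        have h1 : min y (1 / y) ≤ y := min_le_left _ _
        have h2 : y * q / (1 - q) + y = y / (1 - q) := by
          field_simp
          ring
        linarith
      · have h1 : min y (1 / y) ≤ 1 / y := min_le_right _ _
        split_ifs at hstep with h'
        · have h2 : y * q / (1 - q) + 1 / y ≤ (2 - q / y) / (1 - q) := by
            have hy1 : 1 / y ≤ 1 := by
              rw [div_le_one hy]
              linarith
            rw [le_div_iff₀ hs, add_mul, div_mul_cancel₀ _ hs.ne']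
            have : q / y = q * (1 / y) := by ring
            rw [this]
            linarith
          linarith
        · have h2 : (2 - q / (y * q)) / (1 - q) + 1 / y = (2 - q / y) / (1 - q) := by
            field_simp
            ring
          linarith
  refine (key N y hy).trans ?_
  split_ifs with h
  · gcongr
    linarith
  · gcongr
    have : 0 < q / y := by positivity
    linarith

theorem one_sub_pow_mul_sq_le (m : ℕ) {y : ℝ} (hy0 : 0 ≤ y) (hy1 : y ≤ 1) :
    (((m : ℝ) + 1) * y) ^ 2 * (1 - y) ^ m ≤ 2 * Real.exp 1 := by
  have h1 : (1 - y) ^ m ≤ Real.exp (-(m * y)) := by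
    rw [← mul_neg, Real.exp_nat_mul]
    exact pow_le_pow_left₀ (by linarith) (Real.one_sub_le_exp_neg y) m
  have h2 : (((m : ℝ) + 1) * y) ^ 2 ≤ (m * y + 1) ^ 2 := by
    gcongr
    linarith
  have h3 : (m * y + 1) ^ 2 ≤ 2 * Real.exp (m * y + 1) := by
    have := Real.quadratic_le_exp_of_nonneg (x := m * y + 1) (by positivity)
    nlinarith [mul_nonneg (Nat.cast_nonneg (α := ℝ) m) hy0]
  calc _ ≤ (2 * Real.exp (m * y + 1)) * Real.exp (-(m * y)) := by
        gcongr
        · exact h2.trans h3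
    _ = 2 * Real.exp 1 := by
        rw [mul_assoc, ← Real.exp_add]
        ring_nf

/-- With `b = ℙ(X ⊆ S)` and `a b = ℙ(X = S)`, an upper bound for the probability that `S` is a
minimal edge among `m + 1` samples. -/
theorem minimal_prob_le {a b q : ℝ} (m : ℕ) (hq0 : 0 < q) (hq1 : q ≤ 1) (ha0 : 0 ≤ a)
    (ha1 : a ≤ 1 - q) (hb0 : 0 < b) (hb1 : b ≤ 1) :
    (1 - (b - a * b)) ^ (m + 1) - (1 - b) ^ (m + 1) ≤
      a * (2 * Real.exp 1 / q ^ 2 * min ((m + 1) * b) (1 / ((m + 1) * b))) := by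
  have hE : (1 : ℝ) ≤ Real.exp 1 := by linarith [Real.add_one_le_exp (1 : ℝ)]
  have hy0 : 0 ≤ b - a * b := by nlinarith
  have hy1 : b - a * b ≤ 1 := by nlinarith
  have h := pow_succ_sub_pow_succ_le (x := 1 - (b - a * b)) (y := 1 - b) (by linarith)
    (by nlinarith) m
  rw [show (1 - (b - a * b)) - (1 - b) = a * b by ring] at h
  refine h.trans ?_
  rw [show ((m : ℝ) + 1) * (a * b) * (1 - (b - a * b)) ^ m =
    a * ((m + 1) * b * (1 - (b - a * b)) ^ m) by ring]
  refine mul_le_mul_of_nonneg_left ?_ ha0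
  have hK : 1 ≤ 2 * Real.exp 1 / q ^ 2 := by
    rw [le_div_iff₀ (by positivity)]
    nlinarith
  rw [mul_min_of_nonneg _ _ (by positivity)]
  refine le_min ?_ ?_
  · calc _ ≤ ((m : ℝ) + 1) * b * 1 := by
          gcongr
          exact pow_le_one₀ (by linarith) (by linarith)
      _ ≤ _ := by
          rw [mul_one]
          exact le_mul_of_one_le_left (by positivity) hK
  · rw [mul_one_div, div_div, le_div_iff₀ (by positivity)]
    have hqb : q * b ≤ b - a * b := by nlinarith
    calc _ = (((m : ℝ) + 1) * (q * b)) ^ 2 * (1 - (b - a * b)) ^ m := by ring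
      _ ≤ (((m : ℝ) + 1) * (b - a * b)) ^ 2 * (1 - (b - a * b)) ^ m := by
          have : 0 ≤ 1 - (b - a * b) := by linarith
          gcongr
      _ ≤ _ := one_sub_pow_mul_sq_le m hy0 hy1

theorem le_minimal_prob {a b q : ℝ} (m : ℕ) (hq : q < 1) (ha0 : 0 ≤ a)
    (hb0 : 0 < b) (hb1 : b ≤ q) (hm0 : 1 ≤ (m + 1) * b) (hm1 : m * b ≤ 1) :
    a * Real.exp (-1 / (1 - q)) ≤ (1 - (b - a * b)) ^ (m + 1) - (1 - b) ^ (m + 1) := by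
  have hs : 0 < 1 - q := by linarith
  have hsb : 0 < 1 - b := by linarith
  have h := le_pow_succ_sub_pow_succ (x := 1 - (b - a * b)) (y := 1 - b) (by linarith)
    (by nlinarith) m
  rw [show (1 - (b - a * b)) - (1 - b) = a * b by ring] at h
  refine le_trans ?_ h
  have hexp : Real.exp (-1 / (1 - q)) ≤ (1 - b) ^ m := by
    have h1 : Real.exp (-(b / (1 - b))) ≤ 1 - b := by
      rw [Real.exp_neg, inv_le_comm₀ (Real.exp_pos _) hsb]
      refine le_trans (le_of_eq ?_) (Real.add_one_le_exp _)
      field_simp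
      ring
    calc Real.exp (-1 / (1 - q)) ≤ Real.exp (m * -(b / (1 - b))) := by
          rw [Real.exp_le_exp, neg_div, mul_neg, neg_le_neg_iff, ← mul_div_assoc]
          gcongr
      _ = Real.exp (-(b / (1 - b))) ^ m := Real.exp_nat_mul _ _
      _ ≤ _ := pow_le_pow_left₀ (Real.exp_pos _).le h1 m
  calc a * Real.exp (-1 / (1 - q)) ≤ a * (1 - b) ^ m := by gcongr
    _ = 1 * (a * (1 - b) ^ m) := (one_mul _).symm
    _ ≤ ((m + 1) * b) * (a * (1 - b) ^ m) := by gcongr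
    _ = _ := by ring

theorem choose_mul_pow_eq {p : ℝ} (hp : 0 < p) {n k : ℕ} (hk : k ≤ n) :
    (n.choose k : ℝ) * (p / (1 + p)) ^ k * (1 - p / (1 + p)) ^ (n - k) =
      (n.choose k : ℝ) * p ^ k / (1 + p) ^ n := by
  obtain ⟨l, rfl⟩ := Nat.exists_eq_add_of_le hk
  rw [Nat.add_sub_cancel_left, show 1 - p / (1 + p) = 1 / (1 + p) by field_simp; ring, div_pow,
    div_pow, pow_add]
  field_simp
  simp

theorem exists_choose_mul_pow_le {p : ℝ} (hp : 0 < p) :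
    ∃ C > (0 : ℝ), ∀ n : ℕ, 0 < n → ∀ k ≤ n,
      (n.choose k : ℝ) * p ^ k ≤ C * (1 + p) ^ n / √n := by
  obtain ⟨C, hC, h⟩ := exists_bernstein_le (p / (1 + p)) (by positivity)
    ((div_lt_one (by positivity)).2 (by linarith))
  refine ⟨C, hC, fun n hn k hk => ?_⟩
  have := h n hn k hk
  rw [choose_mul_pow_eq hp hk, div_le_iff₀ (by positivity)] at this
  exact this.trans_eq (by ring)

theorem exists_le_choose_mul_pow {p : ℝ} (hp0 : 0 < p) (hp1 : p ≤ 1) {n : ℕ} (hn : 0 < n) :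
    ∃ k < n, 1 / 5 * (1 + p) ^ n / √n ≤ (n.choose k : ℝ) * p ^ k := by
  obtain ⟨k, hk, h⟩ := exists_le_bernstein hn (r := p / (1 + p)) (by positivity)
    ((div_lt_one (by positivity)).2 (by linarith))
  rw [choose_mul_pow_eq hp0 hk, le_div_iff₀ (by positivity)] at h
  have h' : 1 / 5 * (1 + p) ^ n / √n ≤ (n.choose k : ℝ) * p ^ k :=
    le_trans (le_of_eq (by field_simp)) h
  rcases hk.lt_or_eq with hlt | rfl
  · exact ⟨k, hlt, h'⟩
  · refine ⟨k - 1, by omega, h'.trans ?_⟩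
    obtain ⟨l, rfl⟩ := Nat.exists_eq_succ_of_ne_zero hn.ne'
    simp only [Nat.succ_eq_add_one, Nat.choose_self, Nat.add_sub_cancel, Nat.choose_succ_self_right,
      Nat.cast_one, one_mul]
    calc p ^ (l + 1) = p * p ^ l := by ring
      _ ≤ ((l + 1 : ℕ) : ℝ) * p ^ l := by
        gcongr
        push_cast
        linarith [Nat.cast_nonneg (α := ℝ) l]

theorem expMin_succ_le {p C : ℝ} (hp0 : 0 < p) (hp1 : p < 1) {n : ℕ} (hn : 0 < n)
    (hC : ∀ k ≤ n, (n.choose k : ℝ) * p ^ k ≤ C * (1 + p) ^ n / √n) (hC0 : 0 < C) (m : ℕ) :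
    expMin n (m + 1) p ≤
      (1 / p + C * (2 * Real.exp 1 / (1 - p) ^ 2 * (2 / p))) * (1 + p) ^ n / √n := by
  have hq : 0 < 1 - p := by linarith
  have hn' : (0 : ℝ) < n := by exact_mod_cast hn
  rw [expMin_eq_sum n (m + 1) hp0.le hp1.le, Finset.sum_range_succ']
  have hone : 1 ≤ 1 / p * (1 + p) ^ n / √n := by
    rw [le_div_iff₀ (by positivity), one_mul, one_div, inv_mul_eq_div, le_div_iff₀ hp0]
    have h1 := one_add_mul_le_pow (by linarith : (-2 : ℝ) ≤ p) n
    have h2 : √(n : ℝ) ≤ n := by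
      rw [Real.sqrt_le_left hn'.le]
      nlinarith [(by exact_mod_cast hn : (1 : ℝ) ≤ n)]
    nlinarith
  have hzero : (n.choose 0 : ℝ) * ((1 - ((1 - p) ^ (n - 0) - p ^ 0 * (1 - p) ^ (n - 0))) ^ (m + 1) -
      (1 - (1 - p) ^ (n - 0)) ^ (m + 1)) ≤ 1 := by
    have : (1 - p) ^ n ≤ 1 := pow_le_one₀ hq.le (by linarith)
    have : 0 ≤ (1 - (1 - p) ^ n) ^ (m + 1) := pow_nonneg (by linarith) _
    simp
    linarith
  have hterm : ∀ j ∈ Finset.range n, (n.choose (j + 1) : ℝ) *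
      ((1 - ((1 - p) ^ (n - (j + 1)) - p ^ (j + 1) * (1 - p) ^ (n - (j + 1)))) ^ (m + 1) -
        (1 - (1 - p) ^ (n - (j + 1))) ^ (m + 1)) ≤
      C * (1 + p) ^ n / √n * (2 * Real.exp 1 / (1 - p) ^ 2) *
        min (((m : ℝ) + 1) * (1 - p) ^ (n - 1 - j)) (1 / ((m + 1) * (1 - p) ^ (n - 1 - j))) := by
    intro j hj
    have hj' : j + 1 ≤ n := by simpa [Nat.succ_le_iff] using hj
    have hb := minimal_prob_le (a := p ^ (j + 1)) (b := (1 - p) ^ (n - (j + 1))) m hq (by linarith)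
      (by positivity) (by
        rw [sub_sub_cancel]
        exact pow_le_of_le_one hp0.le hp1.le (by omega)) (by positivity)
      (pow_le_one₀ hq.le (by linarith))
    rw [show n - 1 - j = n - (j + 1) by omega]
    calc _ ≤ (n.choose (j + 1) : ℝ) * _ := mul_le_mul_of_nonneg_left hb (by positivity)
      _ = (n.choose (j + 1) : ℝ) * p ^ (j + 1) * (2 * Real.exp 1 / (1 - p) ^ 2 *
          min (((m : ℝ) + 1) * (1 - p) ^ (n - (j + 1)))
            (1 / ((m + 1) * (1 - p) ^ (n - (j + 1))))) := by ring
      _ ≤ C * (1 + p) ^ n / √n * (2 * Real.exp 1 / (1 - p) ^ 2 *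
          min (((m : ℝ) + 1) * (1 - p) ^ (n - (j + 1)))
            (1 / ((m + 1) * (1 - p) ^ (n - (j + 1))))) := by
          gcongr
          exact hC _ hj'
      _ = _ := by ring
  have hgeom := sum_min_geometric_le hq (by linarith) n (y := (m : ℝ) + 1) (by positivity)
  rw [← Finset.sum_range_reflect, sub_sub_cancel] at hgeom
  calc _ ≤ C * (1 + p) ^ n / √n * (2 * Real.exp 1 / (1 - p) ^ 2) * (2 / p) +
        1 / p * (1 + p) ^ n / √n := by
        refine add_le_add ?_ (hzero.trans hone)
        refine (Finset.sum_le_sum hterm).trans ?_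
        rw [← Finset.mul_sum]
        gcongr
    _ = _ := by ring

theorem exists_le_expMin {p : ℝ} (hp0 : 0 < p) (hp1 : p < 1) {n k : ℕ} (hk : k < n) :
    ∃ m : ℕ, 0 < m ∧ (n.choose k : ℝ) * p ^ k * Real.exp (-1 / p) ≤ expMin n m p := by
  have hq : 0 < 1 - p := by linarith
  set b := (1 - p) ^ (n - k) with hb
  have hb0 : 0 < b := by positivity
  have hm0 : 1 ≤ ((⌊1 / b⌋₊ : ℝ) + 1) * b := by
    have := (Nat.lt_floor_add_one (1 / b)).le
    rwa [div_le_iff₀ hb0] at this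
  have hm1 : (⌊1 / b⌋₊ : ℝ) * b ≤ 1 := by
    have := Nat.floor_le (by positivity : 0 ≤ 1 / b)
    rwa [le_div_iff₀ hb0] at this
  refine ⟨⌊1 / b⌋₊ + 1, by omega, ?_⟩
  rw [expMin_eq_sum n _ hp0.le hp1.le]
  have h := le_minimal_prob (a := p ^ k) (b := b) (q := 1 - p) ⌊1 / b⌋₊ (by linarith)
    (by positivity) hb0 (pow_le_of_le_one hq.le (by linarith) (by omega)) hm0 hm1
  rw [sub_sub_cancel] at h
  rw [mul_assoc]
  refine (mul_le_mul_of_nonneg_left h (by positivity)).trans ?_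
  refine Finset.single_le_sum (f := fun k : ℕ => (n.choose k : ℝ) *
    ((1 - ((1 - p) ^ (n - k) - p ^ k * (1 - p) ^ (n - k))) ^ (⌊1 / b⌋₊ + 1) -
      (1 - (1 - p) ^ (n - k)) ^ (⌊1 / b⌋₊ + 1))) (fun i _ => ?_) (Finset.mem_range.2 (by omega))
  refine mul_nonneg (by positivity) (sub_nonneg.2 (pow_le_pow_left₀ ?_ ?_ _))
  · linarith [pow_le_one₀ (n := n - i) hq.le (by linarith : 1 - p ≤ 1)]
  · have : 0 ≤ p ^ i * (1 - p) ^ (n - i) := by positivity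
    linarith

/-- **Maximum size of the minimization.** The maximum over `m` of the expected number of
minimal edges of `B_{n,m,p}` is `Θ((1+p)^n/√n)`: for constants `c, C > 0` depending only
on `p`, every `m` gives expectation at most `C·(1+p)^n/√n`, and some `m` achieves at
least `c·(1+p)^n/√n`. -/
theorem max_minimization (p : ℝ) (hp0 : 0 < p) (hp1 : p < 1) :
    ∃ c > (0 : ℝ), ∃ C > (0 : ℝ), ∀ n : ℕ, 0 < n →
      (∀ m : ℕ, 0 < m → expMin n m p ≤ C * (1 + p) ^ n / Real.sqrt n) ∧
      (∃ m : ℕ, 0 < m ∧ c * (1 + p) ^ n / Real.sqrt n ≤ expMin n m p) := by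
  obtain ⟨C, hC0, hC⟩ := exists_choose_mul_pow_le hp0
  have hq : 0 < 1 - p := by linarith
  refine ⟨1 / 5 * Real.exp (-1 / p), by positivity,
    1 / p + C * (2 * Real.exp 1 / (1 - p) ^ 2 * (2 / p)), by positivity, fun n hn => ⟨?_, ?_⟩⟩
  · intro m hm
    obtain ⟨l, rfl⟩ := Nat.exists_eq_succ_of_ne_zero hm.ne'
    exact expMin_succ_le hp0 hp1 hn (hC n hn) hC0 l
  · obtain ⟨k, hk, h⟩ := exists_le_choose_mul_pow hp0 hp1.le hn
    obtain ⟨m, hm, hle⟩ := exists_le_expMin hp0 hp1 hk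
    refine ⟨m, hm, le_trans ?_ hle⟩
    calc _ = 1 / 5 * (1 + p) ^ n / √n * Real.exp (-1 / p) := by ring
      _ ≤ _ := by gcongr
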